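/- arXiv:2511.09703 — 2 statements merged into one kernel-verified Lean document; each statement's English description precedes it below -/
import Mathlib

section
/- Let v ∈ Σ* and q ∈ Q be such that M(v)[q] is a maximal column. Then for every u ∈ Σ*, the vector M(uv)[q] = M(u)M(v)[q] is also a maximal column. -/
open Matrix

/-- Indicator (0/1) column vector of a set of states: `ind S q = 1` iff `q ∈ S`. -/
noncomputable def ind {Q : Type*} (S : Set Q) : Q → ℝ := S.indicator 1

namespace UFA

variable {Q σ : Type*}

/-- `y` is a column of the monoid morphism `M`, i.e. `y = M(w)[q]` for some word `w`, state `q`. -/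
def IsCol (M : List σ → Matrix Q Q ℝ) (y : Q → ℝ) : Prop :=
  ∃ w : List σ, ∃ q : Q, y = fun p => M w p q

/-- `x` is a row of `M`, i.e. `xᵀ = [q]ᵀ M(w)` for some word `w` and state `q`. -/
def IsRow (M : List σ → Matrix Q Q ℝ) (x : Q → ℝ) : Prop :=
  ∃ w : List σ, ∃ q : Q, x = fun p => M w q p

/-- A maximal column: a column `y` such that no column `y' ≠ y` satisfies `y' ≥ y`. -/
def IsMaxCol (M : List σ → Matrix Q Q ℝ) (y : Q → ℝ) : Prop :=
  IsCol M y ∧ ∀ y', IsCol M y' → y ≤ y' → y' = y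

/-- A maximal row: a row `x` such that no row `x' ≠ x` satisfies `x' ≥ x`. -/
def IsMaxRow (M : List σ → Matrix Q Q ℝ) (x : Q → ℝ) : Prop :=
  IsRow M x ∧ ∀ x', IsRow M x' → x ≤ x' → x' = x

/-- Unambiguous rank of a zero-one matrix: the least `r` such that `A = C * R` with `C, R`
zero-one matrices having `r` columns resp. `r` rows. -/
noncomputable def rankUnMat (A : Matrix Q Q ℝ) : ℕ :=
  sInf {r : ℕ | ∃ C : Matrix Q (Fin r) ℝ, ∃ R : Matrix (Fin r) Q ℝ,
    (∀ i j, C i j = 0 ∨ C i j = 1) ∧ (∀ i j, R i j = 0 ∨ R i j = 1) ∧ A = C * R}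

/-- Minimum unambiguous rank of the matrix monoid generated by `M`. -/
noncomputable def rankUn (M : List σ → Matrix Q Q ℝ) : ℕ :=
  sInf (Set.range fun w => rankUnMat (M w))

/-- Minimum real rank of the matrix monoid generated by `M`. -/
noncomputable def rankReal [Fintype Q] (M : List σ → Matrix Q Q ℝ) : ℕ :=
  sInf (Set.range fun w => (M w).rank)

/-- `Mer M q`: the set of states that appear together with `q` in some column. -/
def Mer (M : List σ → Matrix Q Q ℝ) (q : Q) : Set Q :=
  {q' | ∃ S : Set Q, q ∈ S ∧ q' ∈ S ∧ IsCol M (ind S)}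

end UFA

namespace UFA

section StationaryWeight

variable {Q σ : Type*} [Fintype Q] [DecidableEq Q] [Fintype σ] {M : List σ → Matrix Q Q ℝ}

/-- The average of the matrices of the letters. -/
noncomputable def letterAvg (M : List σ → Matrix Q Q ℝ) : Matrix Q Q ℝ :=
  (Fintype.card σ : ℝ)⁻¹ • ∑ a, M [a]

lemma mul_letterAvg_pow_succ (hMm : ∀ u v, M (u ++ v) = M u * M v) (w : List σ) (k : ℕ) :
    M w * letterAvg M ^ (k + 1)
      = (Fintype.card σ : ℝ)⁻¹ • ∑ a, M (w ++ [a]) * letterAvg M ^ k := by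
  rw [pow_succ', ← mul_assoc]
  nth_rewrite 1 [letterAvg]
  rw [Matrix.mul_smul, Matrix.mul_sum, Matrix.smul_mul, Matrix.sum_mul]
  simp [hMm]

lemma avg_mem_Icc [Nonempty σ] {f : σ → ℝ} {a b : ℝ} (hf : ∀ i, f i ∈ Set.Icc a b) :
    (Fintype.card σ : ℝ)⁻¹ * ∑ i, f i ∈ Set.Icc a b := by
  have hc : (0 : ℝ) < Fintype.card σ := by exact_mod_cast Fintype.card_pos
  have h1 : ∑ _i : σ, a ≤ ∑ i, f i := Finset.sum_le_sum fun i _ => (hf i).1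
  have h2 : ∑ i, f i ≤ ∑ _i : σ, b := Finset.sum_le_sum fun i _ => (hf i).2
  simp only [Finset.sum_const, Finset.card_univ, nsmul_eq_mul] at h1 h2
  rw [inv_mul_eq_div]
  exact ⟨by rw [le_div_iff₀ hc]; linarith, by rw [div_le_iff₀ hc]; linarith⟩

lemma mul_letterAvg_pow_apply_mem_Icc [Nonempty σ] (hMm : ∀ u v, M (u ++ v) = M u * M v)
    (hUn : ∀ w i j, M w i j = 0 ∨ M w i j = 1) (k : ℕ) (w : List σ) (i j : Q) :
    (M w * letterAvg M ^ k) i j ∈ Set.Icc (0 : ℝ) 1 := by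
  induction k generalizing w with
  | zero => rcases hUn w i j with h | h <;> simp [h]
  | succ k ih =>
    rw [mul_letterAvg_pow_succ hMm, Matrix.smul_apply, Matrix.sum_apply, smul_eq_mul]
    exact avg_mem_Icc fun a => ih _

lemma one_le_sum_mul_letterAvg_pow [Nonempty σ] (hMm : ∀ u v, M (u ++ v) = M u * M v)
    (hUn : ∀ w i j, M w i j = 0 ∨ M w i j = 1) (hComp : ∀ w, M w ≠ 0) (k : ℕ) (w : List σ) :
    1 ≤ ∑ j, ∑ i, (M w * letterAvg M ^ k) i j := by
  induction k generalizing w with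
  | zero =>
    have hnn : ∀ i j, 0 ≤ M w i j := fun i j => by rcases hUn w i j with h | h <;> simp [h]
    obtain ⟨i, j, hij⟩ : ∃ i j, M w i j ≠ 0 := by
      by_contra! h
      exact hComp w (Matrix.ext h)
    rw [pow_zero, mul_one, ← (hUn w i j).resolve_left hij]
    exact (Finset.single_le_sum (f := fun i => M w i j) (fun i _ => hnn i j)
      (Finset.mem_univ i)).trans (Finset.single_le_sum (f := fun j => ∑ i, M w i j)
        (fun j _ => Finset.sum_nonneg fun i _ => hnn i j) (Finset.mem_univ j))
  | succ k ih =>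
    have hc : (0 : ℝ) < Fintype.card σ := by exact_mod_cast Fintype.card_pos
    have key : ∑ j, ∑ i, (M w * letterAvg M ^ (k + 1)) i j
        = (Fintype.card σ : ℝ)⁻¹ * ∑ a, ∑ j, ∑ i, (M (w ++ [a]) * letterAvg M ^ k) i j := by
      simp only [mul_letterAvg_pow_succ hMm, Matrix.smul_apply, Matrix.sum_apply, smul_eq_mul,
        ← Finset.mul_sum]
      congr 1
      rw [Finset.sum_comm (s := (Finset.univ : Finset σ))]
      exact Finset.sum_congr rfl fun j _ => Finset.sum_comm
    rw [key, inv_mul_eq_div, le_div_iff₀ hc, one_mul]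
    calc (Fintype.card σ : ℝ) = ∑ _a : σ, (1 : ℝ) := by simp
      _ ≤ _ := Finset.sum_le_sum fun a _ => ih _

open Filter Topology in
/-- If the rows `1 ᵥ* A ^ k` are nonnegative, bounded and of sum at least one, then `A` has a
nonnegative nonzero fixed row vector. -/
lemma exists_vecMul_eq_self_of_bounded {A : Matrix Q Q ℝ} {b : ℝ}
    (hb : ∀ k j, (1 ᵥ* A ^ k) j ∈ Set.Icc 0 b) (hs : ∀ k, 1 ≤ ∑ j, (1 ᵥ* A ^ k) j) :
    ∃ α : Q → ℝ, 0 ≤ α ∧ 1 ≤ ∑ j, α j ∧ α ᵥ* A = α := by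
  set r : ℕ → Q → ℝ := fun k => 1 ᵥ* A ^ k with hr
  set c : ℕ → Q → ℝ := fun n => ((n : ℝ) + 1)⁻¹ • ∑ k ∈ Finset.range (n + 1), r k with hcdef
  have hn : ∀ n : ℕ, (0 : ℝ) < (n : ℝ) + 1 := fun n => by positivity
  have hcI : ∀ n, c n ∈ Set.Icc (0 : Q → ℝ) (fun _ => b) := by
    refine fun n => ⟨fun j => ?_, fun j => ?_⟩
    · simp only [hcdef, Pi.smul_apply, Finset.sum_apply, smul_eq_mul, Pi.zero_apply]
      exact mul_nonneg (inv_nonneg.2 (hn n).le) (Finset.sum_nonneg fun k _ => (hb k j).1)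
    · simp only [hcdef, Pi.smul_apply, Finset.sum_apply, smul_eq_mul]
      rw [inv_mul_eq_div, div_le_iff₀ (hn n)]
      calc _ ≤ ∑ k ∈ Finset.range (n + 1), b := Finset.sum_le_sum fun k _ => (hb k j).2
        _ = _ := by simp; ring
  have hcs : ∀ n, 1 ≤ ∑ j, c n j := by
    intro n
    simp only [hcdef, Pi.smul_apply, Finset.sum_apply, smul_eq_mul, ← Finset.mul_sum]
    rw [Finset.sum_comm, inv_mul_eq_div, le_div_iff₀ (hn n)]
    calc 1 * ((n : ℝ) + 1) = ∑ k ∈ Finset.range (n + 1), (1 : ℝ) := by simp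
      _ ≤ _ := Finset.sum_le_sum fun k _ => hs k
  have hcA : ∀ n, c n ᵥ* A - c n = ((n : ℝ) + 1)⁻¹ • (r (n + 1) - r 0) := by
    intro n
    have hrs : ∀ k, r k ᵥ* A = r (k + 1) := fun k => by
      simp [hr, Matrix.vecMul_vecMul, pow_succ]
    simp only [hcdef, Matrix.smul_vecMul, Matrix.sum_vecMul, hrs]
    rw [← smul_sub, ← Finset.sum_sub_distrib, Finset.sum_range_sub]
  obtain ⟨α, hα, φ, hφ, hlim⟩ := isCompact_Icc.tendsto_subseq hcI
  refine ⟨α, hα.1, ?_, ?_⟩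
  · have : Tendsto (fun n => ∑ j, c (φ n) j) atTop (𝓝 (∑ j, α j)) :=
      tendsto_finsetSum _ fun j _ => (tendsto_pi_nhds.1 hlim j)
    exact ge_of_tendsto' this fun n => hcs _
  · have hcont : Continuous fun x : Q → ℝ => x ᵥ* A - x := by fun_prop
    have h1 : Tendsto (fun n => c (φ n) ᵥ* A - c (φ n)) atTop (𝓝 (α ᵥ* A - α)) :=
      (hcont.tendsto α).comp hlim
    have h0 : Tendsto (fun n => c n ᵥ* A - c n) atTop (𝓝 0) := by
      rw [tendsto_pi_nhds]
      intro j
      have hbd : ∀ n : ℕ, |(c n ᵥ* A - c n) j| ≤ b * (1 / ((n : ℝ) + 1)) := by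
        intro n
        rw [hcA, Pi.smul_apply, Pi.sub_apply, smul_eq_mul, abs_mul, abs_inv, abs_of_pos (hn n),
          one_div, mul_comm]
        refine mul_le_mul_of_nonneg_right ?_ (inv_nonneg.2 (hn n).le)
        have h1 := hb (n + 1) j
        have h2 := hb 0 j
        exact abs_le.2 ⟨by linarith [h1.1, h2.2], by linarith [h1.2, h2.1]⟩
      refine squeeze_zero_norm hbd ?_
      simpa using (tendsto_one_div_add_atTop_nhds_zero_nat (𝕜 := ℝ)).const_mul b
    exact sub_eq_zero.1 (tendsto_nhds_unique h1 (h0.comp hφ.tendsto_atTop))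

lemma pos_of_vecMul_letterAvg_eq_self [Nonempty σ] (hM0 : M [] = 1)
    (hMm : ∀ u v, M (u ++ v) = M u * M v)
    (hUn : ∀ w i j, M w i j = 0 ∨ M w i j = 1) (hSC : ∀ p q : Q, ∃ w, M w p q = 1)
    {α : Q → ℝ} (h0 : 0 ≤ α) (hne : α ≠ 0) (hα : α ᵥ* letterAvg M = α) (r : Q) : 0 < α r := by
  have hnn : ∀ w i j, 0 ≤ M w i j := fun w i j => by rcases hUn w i j with h | h <;> simp [h]
  have hvnn : ∀ w r, 0 ≤ (α ᵥ* M w) r := fun w r =>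
    Finset.sum_nonneg fun i _ => mul_nonneg (h0 i) (hnn w i r)
  have hstep : ∀ a r, α r = 0 → (α ᵥ* M [a]) r = 0 := by
    intro a r hr
    have h : (α ᵥ* letterAvg M) r = 0 := by rw [hα, hr]
    rw [letterAvg, Matrix.vecMul_smul, Matrix.vecMul_sum, Pi.smul_apply, Finset.sum_apply,
      smul_eq_mul, mul_eq_zero] at h
    have h := h.resolve_left (by simp)
    exact (Finset.sum_eq_zero_iff_of_nonneg fun b _ => hvnn [b] r).1 h a (Finset.mem_univ a)
  have hterm : ∀ w r, (α ᵥ* M w) r = 0 → ∀ s, α s * M w s r = 0 := fun w r h s =>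
    (Finset.sum_eq_zero_iff_of_nonneg fun i _ => mul_nonneg (h0 i) (hnn w i r)).1 h s
      (Finset.mem_univ s)
  have hword : ∀ w r, α r = 0 → (α ᵥ* M w) r = 0 := by
    intro w
    induction w using List.reverseRecOn with
    | nil => intro r hr; simp [hM0, hr]
    | append_singleton w a ih =>
      intro r hr
      rw [hMm, ← Matrix.vecMul_vecMul]
      refine Finset.sum_eq_zero fun s _ => ?_
      rcases mul_eq_zero.1 (hterm _ _ (hstep a r hr) s) with h | h
      · exact mul_eq_zero_of_left (ih s h) _
      · exact mul_eq_zero_of_right _ h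
  refine lt_of_le_of_ne (h0 r) fun hr => hne (funext fun p => ?_)
  obtain ⟨w, hw⟩ := hSC p r
  simpa [hw] using hterm w r (hword w r hr.symm) p

/-- A complete strongly connected unambiguous morphism has a positive row vector that is
stationary for the letter average. -/
lemma exists_pos_stationary [Nonempty σ] (hM0 : M [] = 1) (hMm : ∀ u v, M (u ++ v) = M u * M v)
    (hUn : ∀ w i j, M w i j = 0 ∨ M w i j = 1) (hComp : ∀ w, M w ≠ 0)
    (hSC : ∀ p q : Q, ∃ w, M w p q = 1) :
    ∃ α : Q → ℝ, (∀ r, 0 < α r) ∧ α ᵥ* letterAvg M = α := by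
  have hrow : ∀ k j, (1 ᵥ* letterAvg M ^ k) j = ∑ i, (M [] * letterAvg M ^ k) i j := by
    intro k j
    simp [hM0, Matrix.vecMul, dotProduct]
  obtain ⟨α, h0, hs, hα⟩ := exists_vecMul_eq_self_of_bounded (A := letterAvg M)
    (b := Fintype.card Q) (fun k j => by
      have h := mul_letterAvg_pow_apply_mem_Icc hMm hUn k []
      rw [hrow]
      refine ⟨Finset.sum_nonneg fun i _ => (h i j).1, ?_⟩
      calc _ ≤ ∑ _i : Q, (1 : ℝ) := Finset.sum_le_sum fun i _ => (h i j).2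
        _ = _ := by simp)
    (fun k => by simpa only [hrow] using one_le_sum_mul_letterAvg_pow hMm hUn hComp k [])
  refine ⟨α, pos_of_vecMul_letterAvg_eq_self hM0 hMm hUn hSC h0 ?_ hα, hα⟩
  rintro rfl
  norm_num at hs

end StationaryWeight

section Columns

variable {Q σ : Type*} {M : List σ → Matrix Q Q ℝ}

lemma IsCol.eq_zero_or_one (hUn : ∀ w i j, M w i j = 0 ∨ M w i j = 1) {y : Q → ℝ}
    (hy : IsCol M y) (p : Q) : y p = 0 ∨ y p = 1 := by
  obtain ⟨w, q, rfl⟩ := hy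
  exact hUn w p q

lemma IsCol.nonneg (hUn : ∀ w i j, M w i j = 0 ∨ M w i j = 1) {y : Q → ℝ}
    (hy : IsCol M y) (p : Q) : 0 ≤ y p := by
  rcases hy.eq_zero_or_one hUn p with h | h <;> simp [h]

variable [Fintype Q]

lemma IsCol.mulVec (hMm : ∀ u v, M (u ++ v) = M u * M v) {y : Q → ℝ} (hy : IsCol M y)
    (u : List σ) : IsCol M (M u *ᵥ y) := by
  obtain ⟨w, q, rfl⟩ := hy
  exact ⟨u ++ w, q, by rw [hMm]; rfl⟩

lemma finite_setOf_isCol (hUn : ∀ w i j, M w i j = 0 ∨ M w i j = 1) : {y | IsCol M y}.Finite := by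
  refine (Set.Finite.pi' (t := fun _ : Q => ({0, 1} : Set ℝ)) fun _ => Set.toFinite _).subset ?_
  rintro _ ⟨w, q, rfl⟩ p
  exact hUn w p q

/-- The weight of a column under `α` is the largest possible. -/
def IsMaxWeight (M : List σ → Matrix Q Q ℝ) (α y : Q → ℝ) : Prop :=
  IsCol M y ∧ ∀ y', IsCol M y' → α ⬝ᵥ y' ≤ α ⬝ᵥ y

lemma IsMaxWeight.isMaxCol {α y : Q → ℝ} (hα : ∀ r, 0 < α r) (hy : IsMaxWeight M α y) :
    IsMaxCol M y := by
  refine ⟨hy.1, fun y' hy' hle => ?_⟩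
  have hsum : ∑ i, α i * y i = ∑ i, α i * y' i :=
    le_antisymm (Finset.sum_le_sum fun i _ => mul_le_mul_of_nonneg_left (hle i) (hα i).le)
      (hy.2 y' hy')
  have := (Finset.sum_eq_sum_iff_of_le
    fun i _ => mul_le_mul_of_nonneg_left (hle i) (hα i).le).1 hsum
  exact funext fun i => (mul_left_cancel₀ (hα i).ne' (this i (Finset.mem_univ i))).symm

lemma IsMaxWeight.mulVec [DecidableEq Q] [Fintype σ] [Nonempty σ] (hM0 : M [] = 1)
    (hMm : ∀ u v, M (u ++ v) = M u * M v) {α : Q → ℝ} (hα : α ᵥ* letterAvg M = α) {y : Q → ℝ}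
    (hy : IsMaxWeight M α y) (u : List σ) : IsMaxWeight M α (M u *ᵥ y) := by
  have hletter : ∀ (a : σ) {y : Q → ℝ}, IsMaxWeight M α y → IsMaxWeight M α (M [a] *ᵥ y) := by
    intro a y hy
    have hsum : ∑ a, α ⬝ᵥ (M [a] *ᵥ y) = ∑ _a : σ, α ⬝ᵥ y := by
      have h : α ⬝ᵥ y = (Fintype.card σ : ℝ)⁻¹ * ∑ a, α ⬝ᵥ (M [a] *ᵥ y) := by
        conv_lhs => rw [← hα]
        rw [← Matrix.dotProduct_mulVec, letterAvg, Matrix.smul_mulVec, Matrix.sum_mulVec,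
          dotProduct_smul, dotProduct_sum, smul_eq_mul]
      have hc : (Fintype.card σ : ℝ) ≠ 0 := by simp
      rw [Finset.sum_const, Finset.card_univ, nsmul_eq_mul, h, mul_inv_cancel_left₀ hc]
    have heq := (Finset.sum_eq_sum_iff_of_le
      fun b _ => hy.2 _ (hy.1.mulVec hMm [b])).1 hsum a (Finset.mem_univ a)
    exact ⟨hy.1.mulVec hMm [a], fun y' hy' => heq ▸ hy.2 y' hy'⟩
  induction u with
  | nil => simpa [hM0] using hy
  | cons a u ih =>
    rw [← List.singleton_append, hMm, ← Matrix.mulVec_mulVec]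
    exact hletter a ih

lemma exists_isMaxWeight [Nonempty Q] (hUn : ∀ w i j, M w i j = 0 ∨ M w i j = 1) (α : Q → ℝ) :
    ∃ y, IsMaxWeight M α y := by
  obtain ⟨y, hy, hmax⟩ := Set.exists_max_image _ (fun y => α ⬝ᵥ y) (finite_setOf_isCol hUn)
    ⟨_, [], Classical.arbitrary Q, rfl⟩
  exact ⟨y, hy, hmax⟩

/-- Every column is dominated by a column of maximal weight. -/
lemma exists_isMaxWeight_ge [DecidableEq Q] [Fintype σ] [Nonempty σ] (hM0 : M [] = 1)
    (hMm : ∀ u v, M (u ++ v) = M u * M v) (hUn : ∀ w i j, M w i j = 0 ∨ M w i j = 1)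
    (hSC : ∀ p q : Q, ∃ w, M w p q = 1) {α : Q → ℝ} (hpos : ∀ r, 0 < α r)
    (hα : α ᵥ* letterAvg M = α) (v : List σ) (q : Q) :
    ∃ y, IsMaxWeight M α y ∧ (fun p => M v p q) ≤ y := by
  have hnn : ∀ w i j, 0 ≤ M w i j := fun w i j => by rcases hUn w i j with h | h <;> simp [h]
  have : Nonempty Q := ⟨q⟩
  obtain ⟨y, hy⟩ := exists_isMaxWeight hUn α
  obtain ⟨t, ht⟩ : ∃ t, y t = 1 := by
    by_contra! hne
    have hy0 : y = 0 := funext fun t => (hy.1.eq_zero_or_one hUn t).resolve_right (hne t)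
    have hone := congrFun (hy.isMaxCol hpos |>.2 _ ⟨[], q, rfl⟩
      (by rw [hy0]; exact fun p => hnn [] p q)) q
    simp [hM0, hy0] at hone
  obtain ⟨z, hz⟩ := hSC q t
  have hzy : 1 ≤ (M z *ᵥ y) q :=
    calc (1 : ℝ) = M z q t * y t := by rw [hz, ht, one_mul]
      _ ≤ _ := Finset.single_le_sum (f := fun t => M z q t * y t)
        (fun s _ => mul_nonneg (hnn z q s) (hy.1.nonneg hUn s)) (Finset.mem_univ t)
  refine ⟨_, (hy.mulVec hM0 hMm hα z).mulVec hM0 hMm hα v, fun p => ?_⟩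
  calc M v p q ≤ M v p q * (M z *ᵥ y) q := le_mul_of_one_le_right (hnn v p q) hzy
    _ ≤ _ := Finset.single_le_sum (f := fun s => M v p s * (M z *ᵥ y) s)
      (fun s _ => mul_nonneg (hnn v p s) ((hy.1.mulVec hMm z).nonneg hUn s)) (Finset.mem_univ q)

end Columns

end UFA

theorem maxCol_stable_under_left_mul {Q σ : Type*} [Fintype Q] [DecidableEq Q] [Nonempty Q]
    [Fintype σ] [Nonempty σ]
    (M : List σ → Matrix Q Q ℝ)
    (hM0 : M [] = 1) (hMm : ∀ u v, M (u ++ v) = M u * M v)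
    (hUn : ∀ w i j, M w i j = 0 ∨ M w i j = 1)
    (hComp : ∀ w, M w ≠ 0)
    (hSC : ∀ p q : Q, ∃ w, M w p q = 1)
    (v : List σ) (q : Q) (h : UFA.IsMaxCol M (fun p => M v p q)) :
    ∀ u : List σ, UFA.IsMaxCol M (fun p => M (u ++ v) p q) := by
  intro u
  obtain ⟨α, hpos, hα⟩ := UFA.exists_pos_stationary hM0 hMm hUn hComp hSC
  obtain ⟨y, hy, hle⟩ := UFA.exists_isMaxWeight_ge hM0 hMm hUn hSC hpos hα v q
  have huy := (hy.mulVec hM0 hMm hα u).isMaxCol hpos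
  rw [h.2 y hy.1 hle] at huy
  rw [hMm]
  exact huy
end

section
/- Let u ∈ Σ* be a word of minimum rank and r := rank_un(M). Then α^T M(u) β = r · mcw · mrw. -/
open Matrix

namespace UFA

section Nonneg

variable {l m n : Type*} [Fintype m]

theorem mul_entry_nonneg {A : Matrix l m ℝ} {B : Matrix m n ℝ}
    (hA : ∀ i j, 0 ≤ A i j) (hB : ∀ i j, 0 ≤ B i j) (i : l) (j : n) : 0 ≤ (A * B) i j := by
  rw [Matrix.mul_apply]
  exact Finset.sum_nonneg fun k _ => mul_nonneg (hA i k) (hB k j)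

theorem mul_entry_pos {A : Matrix l m ℝ} {B : Matrix m n ℝ}
    (hA : ∀ i j, 0 ≤ A i j) (hB : ∀ i j, 0 ≤ B i j) {i : l} {j : n} (k : m)
    (h₁ : 0 < A i k) (h₂ : 0 < B k j) : 0 < (A * B) i j := by
  rw [Matrix.mul_apply]
  exact Finset.sum_pos' (fun k _ => mul_nonneg (hA i k) (hB k j))
    ⟨k, Finset.mem_univ _, mul_pos h₁ h₂⟩

theorem exists_ne_zero_of_mul_ne_zero {A : Matrix l m ℝ} {B : Matrix m n ℝ} {i : l} {j : n}
    (h : (A * B) i j ≠ 0) : ∃ k, A i k ≠ 0 ∧ B k j ≠ 0 := by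
  rw [Matrix.mul_apply] at h
  obtain ⟨k, -, hk⟩ := Finset.exists_ne_zero_of_sum_ne_zero h
  exact ⟨k, left_ne_zero_of_mul hk, right_ne_zero_of_mul hk⟩

theorem nonneg_of_zero_or_one {A : Matrix l n ℝ} (h : ∀ i j, A i j = 0 ∨ A i j = 1)
    (i : l) (j : n) : 0 ≤ A i j := by
  rcases h i j with h | h <;> simp [h]

theorem pow_entry_nonneg [DecidableEq m] {A : Matrix m m ℝ} (hA : ∀ i j, 0 ≤ A i j) (k : ℕ) :
    ∀ i j, 0 ≤ (A ^ k) i j := by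
  induction k with
  | zero => intro i j; rw [pow_zero, Matrix.one_apply]; split_ifs <;> simp
  | succ k ih => rw [pow_succ]; exact mul_entry_nonneg ih hA

/-- Columns of a nonnegative matrix with a nonnegative inverse have at most one nonzero entry. -/
theorem eq_of_col_pos [DecidableEq m] {N P : Matrix m m ℝ}
    (hN : ∀ i j, 0 ≤ N i j) (hP : ∀ i j, 0 ≤ P i j) (h : N * P = 1) {i j k : m}
    (hj : 0 < N j i) (hk : 0 < N k i) : j = k := by
  have h' : P * N = 1 := mul_eq_one_comm.mp h
  obtain ⟨t, ht, -⟩ := exists_ne_zero_of_mul_ne_zero (A := P) (B := N) (i := i) (j := i)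
    (by rw [h']; simp)
  have ht : 0 < P i t := lt_of_le_of_ne (hP i t) (Ne.symm ht)
  have key : ∀ a, 0 < N a i → a = t := by
    intro a ha
    by_contra hat
    have := mul_entry_pos hN hP i ha ht
    rw [h, Matrix.one_apply_ne hat] at this
    exact lt_irrefl _ this
  rw [key j hj, key k hk]

end Nonneg

/-- An element of a monoid with finitely many powers has an idempotent power of exponent at
least two. -/
theorem exists_idempotent_pow {G : Type*} [Monoid G] (x : G) {s : Set G} (hs : s.Finite)
    (h : ∀ n : ℕ, x ^ n ∈ s) : ∃ k : ℕ, IsIdempotentElem (x ^ (k + 2)) := by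
  obtain ⟨a, b, hab, he⟩ := hs.exists_lt_map_eq_of_forall_mem h
  obtain ⟨d, rfl⟩ := Nat.exists_eq_add_of_lt hab
  have step : ∀ n, a ≤ n → x ^ (n + (d + 1)) = x ^ n := by
    intro n hn
    obtain ⟨c, rfl⟩ := Nat.exists_eq_add_of_le hn
    rw [show a + c + (d + 1) = (a + d + 1) + c by ring, pow_add, ← he, ← pow_add]
  have steps : ∀ k n, a ≤ n → x ^ (n + k * (d + 1)) = x ^ n := by
    intro k
    induction k with
    | zero => simp
    | succ k ih =>
      intro n hn
      rw [show n + (k + 1) * (d + 1) = (n + k * (d + 1)) + (d + 1) by ring,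
        step _ (by omega), ih n hn]
  have hle : a + 2 ≤ (a + 2) * (d + 1) := Nat.le_mul_of_pos_right _ (Nat.succ_pos d)
  refine ⟨(a + 2) * (d + 1) - 2, ?_⟩
  rw [Nat.sub_add_cancel (by omega)]
  unfold IsIdempotentElem
  rw [← pow_add, steps _ _ (by omega)]

theorem finite_zero_one_matrices {m n : Type*} [Finite m] [Finite n] :
    {A : Matrix m n ℝ | ∀ i j, A i j = 0 ∨ A i j = 1}.Finite := by
  have h : {A : m → n → ℝ | ∀ i, A i ∈ {f : n → ℝ | ∀ j, f j ∈ ({0, 1} : Set ℝ)}}.Finite :=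
    Set.Finite.pi' fun _ => Set.Finite.pi' fun _ => Set.toFinite _
  exact h

section Rank

variable {Q : Type*} [Fintype Q] [DecidableEq Q]

theorem rankUnMat_le {Q ι : Type*} [Fintype ι] {A : Matrix Q Q ℝ} (C : Matrix Q ι ℝ)
    (R : Matrix ι Q ℝ) (hC : ∀ i j, C i j = 0 ∨ C i j = 1) (hR : ∀ i j, R i j = 0 ∨ R i j = 1)
    (h : A = C * R) : rankUnMat A ≤ Fintype.card ι := by
  refine Nat.sInf_le ⟨C.submatrix id (Fintype.equivFin ι).symm,
    R.submatrix (Fintype.equivFin ι).symm id, fun _ _ => hC _ _, fun _ _ => hR _ _, ?_⟩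
  rw [Matrix.submatrix_mul_equiv, h, Matrix.submatrix_id_id]

theorem exists_factorization {A : Matrix Q Q ℝ} (hA : ∀ i j, A i j = 0 ∨ A i j = 1) :
    ∃ C : Matrix Q (Fin (rankUnMat A)) ℝ, ∃ R : Matrix (Fin (rankUnMat A)) Q ℝ,
      (∀ i j, C i j = 0 ∨ C i j = 1) ∧ (∀ i j, R i j = 0 ∨ R i j = 1) ∧ A = C * R := by
  refine Nat.sInf_mem (s := {r : ℕ | ∃ C : Matrix Q (Fin r) ℝ, ∃ R : Matrix (Fin r) Q ℝ,
    (∀ i j, C i j = 0 ∨ C i j = 1) ∧ (∀ i j, R i j = 0 ∨ R i j = 1) ∧ A = C * R})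
    ⟨Fintype.card Q, A.submatrix id (Fintype.equivFin Q).symm,
      (1 : Matrix Q Q ℝ).submatrix (Fintype.equivFin Q).symm id, fun _ _ => hA _ _, ?_, ?_⟩
  · intro i j
    rw [Matrix.submatrix_apply, Matrix.one_apply]
    split_ifs <;> simp
  · rw [Matrix.submatrix_mul_equiv, Matrix.mul_one, Matrix.submatrix_id_id]

theorem unique_intermediate {e : Matrix Q Q ℝ} (h01 : ∀ i j, e i j = 0 ∨ e i j = 1)
    (he : e * e = e) {p q s t : Q} (hps : e p s = 1) (hsq : e s q = 1) (hpt : e p t = 1)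
    (htq : e t q = 1) : s = t := by
  by_contra hst
  have h2 : ∑ k ∈ {s, t}, e p k * e k q ≤ (e * e) p q := by
    rw [Matrix.mul_apply]
    exact Finset.sum_le_sum_of_subset_of_nonneg (Finset.subset_univ _) fun k _ _ =>
      mul_nonneg (nonneg_of_zero_or_one h01 p k) (nonneg_of_zero_or_one h01 k q)
  rw [Finset.sum_pair hst, hps, hsq, hpt, htq, he] at h2
  rcases h01 p q with h | h <;> rw [h] at h2 <;> norm_num at h2

/-- An idempotent zero-one matrix restricts to the identity on its fixed points. -/
theorem submatrix_fixed_eq_one {e : Matrix Q Q ℝ} (h01 : ∀ i j, e i j = 0 ∨ e i j = 1)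
    (he : e * e = e) :
    e.submatrix (Subtype.val : {q // e q q = 1} → Q) (Subtype.val : {q // e q q = 1} → Q) = 1 := by
  ext ⟨p, hp⟩ ⟨q, hq⟩
  by_cases hpq : p = q
  · subst hpq; simp [hp]
  · rw [Matrix.one_apply_ne (by simpa using hpq), Matrix.submatrix_apply]
    refine (h01 p q).resolve_right fun h => ?_
    exact hpq (unique_intermediate h01 he hp h h hq)

/-- An idempotent zero-one matrix factors through its fixed points. -/
theorem eq_mul_fixed {e : Matrix Q Q ℝ} (h01 : ∀ i j, e i j = 0 ∨ e i j = 1)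
    (he : e * e = e) :
    e = e.submatrix id (Subtype.val : {q // e q q = 1} → Q) *
      e.submatrix (Subtype.val : {q // e q q = 1} → Q) id := by
  ext p q
  have key : ∀ s, e s s ≠ 1 → e p s * e s q = 0 := by
    intro s hs
    by_contra hne
    have hps := (h01 p s).resolve_left (left_ne_zero_of_mul hne)
    have hsq := (h01 s q).resolve_left (right_ne_zero_of_mul hne)
    obtain ⟨t, hpt, hts⟩ := exists_ne_zero_of_mul_ne_zero (A := e) (B := e) (i := p) (j := s)
      (by rw [he, hps]; exact one_ne_zero)
    have hpt := (h01 p t).resolve_left hpt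
    have hts := (h01 t s).resolve_left hts
    have htq : e t q = 1 := by
      refine (h01 t q).resolve_left fun h0 => ?_
      have := mul_entry_pos (nonneg_of_zero_or_one h01) (nonneg_of_zero_or_one h01) s
        (i := t) (j := q) (by rw [hts]; exact one_pos) (by rw [hsq]; exact one_pos)
      rw [he, h0] at this
      exact lt_irrefl _ this
    have := unique_intermediate h01 he hps hsq hpt htq
    subst this
    exact hs hts
  have hpq : e p q = ∑ s, e p s * e s q := by rw [← Matrix.mul_apply, he]
  rw [hpq]
  change _ = ∑ s : {s // e s s = 1}, e p s * e s q
  rw [← Finset.sum_subtype (Finset.univ.filter fun s => e s s = 1) (by simp)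
    (fun s => e p s * e s q)]
  refine (Finset.sum_subset (Finset.filter_subset _ _) fun s _ hs => key s ?_).symm
  simpa using hs

end Rank

section Morphism

variable {Q σ : Type*} [Fintype Q] [DecidableEq Q] {M : List σ → Matrix Q Q ℝ}

theorem exists_word_pow (hM0 : M [] = 1) (hMm : ∀ u v, M (u ++ v) = M u * M v) (w : List σ)
    (n : ℕ) : ∃ t, M t = M w ^ n := by
  induction n with
  | zero => exact ⟨[], by rw [hM0, pow_zero]⟩
  | succ n ih =>
    obtain ⟨t, ht⟩ := ih
    exact ⟨t ++ w, by rw [hMm, ht, pow_succ]⟩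

theorem mul_pow_succ_eq {m n : Type*} [Fintype m] [DecidableEq m] [Fintype n] [DecidableEq n]
    (C : Matrix m n ℝ) (Y : Matrix n m ℝ) (k : ℕ) :
    (C * Y) ^ (k + 1) = C * ((Y * C) ^ k * Y) := by
  induction k with
  | zero => simp
  | succ k ih =>
    rw [pow_succ, ih, pow_succ]
    simp only [Matrix.mul_assoc]

/-- For a factorization `M u = C * R` of minimum rank, every `R * M v * C` has a nonnegative
inverse. -/
theorem exists_nonneg_inverse (hM0 : M [] = 1) (hMm : ∀ u v, M (u ++ v) = M u * M v)
    (hUn : ∀ w i j, M w i j = 0 ∨ M w i j = 1) {r : ℕ} (hr : ∀ w, r ≤ rankUnMat (M w))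
    {u : List σ} {C : Matrix Q (Fin r) ℝ} {R : Matrix (Fin r) Q ℝ}
    (hC : ∀ i j, 0 ≤ C i j) (hR : ∀ i j, 0 ≤ R i j) (hu : M u = C * R) (v : List σ) :
    ∃ P : Matrix (Fin r) (Fin r) ℝ, (∀ i j, 0 ≤ P i j) ∧ R * M v * C * P = 1 := by
  obtain ⟨k, hk⟩ := exists_idempotent_pow (M (u ++ v))
    (finite_zero_one_matrices (m := Q) (n := Q)) (fun n => by
      obtain ⟨t, ht⟩ := exists_word_pow hM0 hMm (u ++ v) n
      rw [← ht]
      exact hUn t)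
  obtain ⟨t, ht⟩ := exists_word_pow hM0 hMm (u ++ v) (k + 2)
  rw [← ht] at hk
  set Y := R * M v with hY
  have hYnn : ∀ i j, 0 ≤ Y i j := mul_entry_nonneg hR (nonneg_of_zero_or_one (hUn v))
  have hfac : M t = C * ((Y * C) ^ (k + 1) * Y) := by
    rw [ht, hMm, hu, Matrix.mul_assoc, ← hY, mul_pow_succ_eq]
  have hone := submatrix_fixed_eq_one (hUn t) hk
  have hge : r ≤ Fintype.card {q // M t q q = 1} :=
    (hr t).trans (rankUnMat_le _ _ (fun _ _ => hUn t _ _) (fun _ _ => hUn t _ _)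
      (eq_mul_fixed (hUn t) hk))
  have hAB : C.submatrix (Subtype.val : {q // M t q q = 1} → Q) id *
      ((Y * C) ^ (k + 1) *
        Y.submatrix id (Subtype.val : {q // M t q q = 1} → Q)) = 1 := by
    rw [← hone]
    ext i j
    exact (congrFun (congrFun hfac i) j).symm
  have hle : Fintype.card {q // M t q q = 1} ≤ r := by
    have h1 := Matrix.rank_mul_le_left (C.submatrix (Subtype.val : {q // M t q q = 1} → Q) id)
      ((Y * C) ^ (k + 1) * Y.submatrix id (Subtype.val : {q // M t q q = 1} → Q))
    rw [hAB, Matrix.rank_one] at h1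
    simpa using h1.trans (Matrix.rank_le_card_width _)
  have hBA := (Matrix.mul_eq_one_comm_of_card_eq _ _ _ (by simpa using le_antisymm hle hge)).mp hAB
  refine ⟨(Y * C) ^ k * (Y.submatrix id (Subtype.val : {q // M t q q = 1} → Q) *
    C.submatrix (Subtype.val : {q // M t q q = 1} → Q) id), ?_, ?_⟩
  · exact mul_entry_nonneg (pow_entry_nonneg (mul_entry_nonneg hYnn hC) k)
      (mul_entry_nonneg (fun _ _ => hYnn _ _) fun _ _ => hC _ _)
  · rw [← hBA, pow_succ']
    simp only [Matrix.mul_assoc]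

/-- Left multiplication by any word preserves the maximum column weight. -/
theorem weight_mulVec_of_max [Fintype σ] [Nonempty σ] (hM0 : M [] = 1)
    (hMm : ∀ u v, M (u ++ v) = M u * M v) {α : Q → ℝ}
    (hαA : α ᵥ* ((Fintype.card σ : ℝ)⁻¹ • ∑ a : σ, M [a]) = α) {c : ℝ}
    (hmax : ∀ y, IsCol M y → α ⬝ᵥ y ≤ c) {y : Q → ℝ} (hy : IsCol M y) (hyc : α ⬝ᵥ y = c)
    (v : List σ) : IsCol M (M v *ᵥ y) ∧ α ⬝ᵥ (M v *ᵥ y) = c := by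
  have hcol : ∀ v, IsCol M (M v *ᵥ y) := by
    obtain ⟨w, q, rfl⟩ := hy
    intro v
    refine ⟨v ++ w, q, ?_⟩
    rw [hMm]
    rfl
  refine ⟨hcol v, ?_⟩
  induction v with
  | nil => rw [hM0, Matrix.one_mulVec, hyc]
  | cons a v ih =>
    have hcons : ∀ b, M [b] *ᵥ (M v *ᵥ y) = M (b :: v) *ᵥ y := by
      intro b
      rw [Matrix.mulVec_mulVec, ← hMm, List.singleton_append]
    have hcard : (Fintype.card σ : ℝ) ≠ 0 := by exact_mod_cast Fintype.card_ne_zero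
    have hsum : ∑ b : σ, α ⬝ᵥ (M (b :: v) *ᵥ y) = ∑ _b : σ, c := by
      have h := ih
      rw [← hαA, ← Matrix.dotProduct_mulVec, Matrix.smul_mulVec, Matrix.sum_mulVec,
        dotProduct_smul, dotProduct_sum, smul_eq_mul, inv_mul_eq_iff_eq_mul₀ hcard] at h
      simp only [hcons] at h
      rw [h, Finset.sum_const, nsmul_eq_mul, Finset.card_univ]
    exact (Finset.sum_eq_sum_iff_of_le fun b _ => hmax _ (hcol (b :: v))).mp hsum a
      (Finset.mem_univ a)

/-- In a minimum-rank factorization `M u = C * R`, every column of `C` has maximum weight. -/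
theorem vecMul_factor_eq_const [Fintype σ] [Nonempty σ] (hM0 : M [] = 1)
    (hMm : ∀ u v, M (u ++ v) = M u * M v) (hUn : ∀ w i j, M w i j = 0 ∨ M w i j = 1)
    (hSC : ∀ p q : Q, ∃ w, M w p q = 1) {α : Q → ℝ} (hα : ∀ q, 0 < α q)
    (hαA : α ᵥ* ((Fintype.card σ : ℝ)⁻¹ • ∑ a : σ, M [a]) = α) {c : ℝ}
    (hatt : ∃ y, IsCol M y ∧ α ⬝ᵥ y = c) (hmax : ∀ y, IsCol M y → α ⬝ᵥ y ≤ c)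
    {ι : Type*} [Fintype ι] [DecidableEq ι] {u : List σ} {C : Matrix Q ι ℝ} {R : Matrix ι Q ℝ}
    (hC : ∀ i j, C i j = 0 ∨ C i j = 1) (hR : ∀ i j, 0 ≤ R i j) (hu : M u = C * R)
    (hinv : ∀ v, ∃ P : Matrix ι ι ℝ, (∀ i j, 0 ≤ P i j) ∧ R * M v * C * P = 1) :
    α ᵥ* C = fun _ => c := by
  funext j
  have hMnn := fun w => nonneg_of_zero_or_one (hUn w)
  have hCnn := nonneg_of_zero_or_one hC
  obtain ⟨y, hy, hyc⟩ := hatt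
  have hinvariant := weight_mulVec_of_max hM0 hMm hαA hmax hy hyc
  obtain ⟨z, q, hz⟩ := hy
  have hcpos : 0 < c := by
    refine (hα q).trans_le (le_trans (le_of_eq ?_) (hmax _ ⟨[], q, rfl⟩))
    simp [hM0, dotProduct, Matrix.one_apply]
  obtain ⟨p, hp⟩ : ∃ p, M z p q = 1 := by
    by_contra! hne
    have : y = 0 := by
      funext p
      rw [hz]
      exact (hUn z p q).resolve_right (hne p)
    rw [this, dotProduct_zero] at hyc
    exact hcpos.ne hyc
  obtain ⟨P, -, hP⟩ := hinv []
  obtain ⟨q', hq'⟩ : ∃ q', R j q' ≠ 0 := by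
    obtain ⟨k, hk, -⟩ := exists_ne_zero_of_mul_ne_zero (A := R) (B := M [] * C * P)
      (i := j) (j := j) (by
        rw [← Matrix.mul_assoc, ← Matrix.mul_assoc, hP]
        simp)
    exact ⟨k, hk⟩
  obtain ⟨p', hp'⟩ : ∃ p', C p' j ≠ 0 := by
    obtain ⟨k, -, hk⟩ := exists_ne_zero_of_mul_ne_zero (A := P * (R * M [])) (B := C)
      (i := j) (j := j) (by
        rw [Matrix.mul_assoc, mul_eq_one_comm.mp hP]
        simp)
    exact ⟨k, hk⟩
  have hp' := (hC p' j).resolve_left hp'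
  obtain ⟨v, hv⟩ := hSC q' p
  obtain ⟨s, hs⟩ := hSC q p'
  have hMv : M (v ++ z) q' q ≠ 0 := by
    rw [hMm]
    exact (mul_entry_pos (hMnn v) (hMnn z) p (by rw [hv]; exact one_pos)
      (by rw [hp]; exact one_pos)).ne'
  set X := R * M (v ++ z) with hX
  have hXnn : ∀ i j, 0 ≤ X i j := mul_entry_nonneg hR (hMnn _)
  have hXj : 0 < X j q :=
    mul_entry_pos hR (hMnn _) q' ((hR j q').lt_of_ne' hq') ((hMnn _ _ _).lt_of_ne' hMv)
  have hMsC : 0 < (M s * C) q j :=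
    mul_entry_pos (hMnn s) hCnn p' (by rw [hs]; exact one_pos) (by rw [hp']; exact one_pos)
  obtain ⟨P', hP'nn, hP'⟩ := hinv (v ++ z ++ s)
  have hN : R * M (v ++ z ++ s) * C = X * (M s * C) := by
    rw [hMm (v ++ z), hX]
    simp only [Matrix.mul_assoc]
  rw [hN] at hP'
  have hMsCnn := mul_entry_nonneg (hMnn s) hCnn
  have hsupp : ∀ l, l ≠ j → X l q = 0 := by
    intro l hl
    by_contra hne
    exact hl (eq_of_col_pos (mul_entry_nonneg hXnn hMsCnn) hP'nn hP'
      (mul_entry_pos hXnn hMsCnn q ((hXnn l q).lt_of_ne' hne) hMsC)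
      (mul_entry_pos hXnn hMsCnn q hXj hMsC))
  have hentry : ∀ a, M (u ++ v ++ z) a q = C a j * X j q := by
    intro a
    rw [List.append_assoc, hMm, hu, Matrix.mul_assoc, ← hX, Matrix.mul_apply]
    exact Finset.sum_eq_single j (fun l _ hl => by rw [hsupp l hl, mul_zero]) (by simp)
  have hXone : X j q = 1 := by
    have h := hUn (u ++ v ++ z) p' q
    rw [hentry, hp', one_mul] at h
    exact h.resolve_left hXj.ne'
  have hcol : M (u ++ v) *ᵥ y = fun a => C a j := by
    funext a
    have h := hentry a
    rw [hXone, mul_one, hMm] at h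
    rw [hz, ← h]
    rfl
  rw [← (hinvariant (u ++ v)).2, hcol]
  rfl

end Morphism

end UFA

theorem minrank_weight {Q σ : Type*} [Fintype Q] [DecidableEq Q] [Nonempty Q]
    [Fintype σ] [Nonempty σ]
    (M : List σ → Matrix Q Q ℝ)
    (hM0 : M [] = 1) (hMm : ∀ u v, M (u ++ v) = M u * M v)
    (hUn : ∀ w i j, M w i j = 0 ∨ M w i j = 1)
    (hComp : ∀ w, M w ≠ 0)
    (hSC : ∀ p q : Q, ∃ w, M w p q = 1)
    (α β : Q → ℝ) (hα : ∀ q, 0 < α q) (hβ : ∀ q, 0 < β q)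
    (hαA : α ᵥ* ((Fintype.card σ : ℝ)⁻¹ • ∑ a : σ, M [a]) = α)
    (hβA : ((Fintype.card σ : ℝ)⁻¹ • ∑ a : σ, M [a]) *ᵥ β = β)
    (hαβ : α ⬝ᵥ β = 1)
    (mcw : ℝ) (hmcw₁ : ∃ y, UFA.IsCol M y ∧ α ⬝ᵥ y = mcw)
    (hmcw₂ : ∀ y, UFA.IsCol M y → α ⬝ᵥ y ≤ mcw)
    (mrw : ℝ) (hmrw₁ : ∃ x, UFA.IsRow M x ∧ x ⬝ᵥ β = mrw)
    (hmrw₂ : ∀ x, UFA.IsRow M x → x ⬝ᵥ β ≤ mrw)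
    (u : List σ) (hu : UFA.rankUnMat (M u) = UFA.rankUn M) :
    α ⬝ᵥ (M u *ᵥ β) = (UFA.rankUn M : ℝ) * mcw * mrw := by
  obtain ⟨C, R, hC, hR, hCR⟩ := UFA.exists_factorization (hUn u)
  have hr : ∀ w, UFA.rankUnMat (M u) ≤ UFA.rankUnMat (M w) := fun w => by
    rw [hu]
    exact Nat.sInf_le ⟨w, rfl⟩
  have hinv := UFA.exists_nonneg_inverse hM0 hMm hUn hr (UFA.nonneg_of_zero_or_one hC)
    (UFA.nonneg_of_zero_or_one hR) hCR
  have hcols := UFA.vecMul_factor_eq_const hM0 hMm hUn hSC hα hαA hmcw₁ hmcw₂ hC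
    (UFA.nonneg_of_zero_or_one hR) hCR hinv
  have hrows := UFA.vecMul_factor_eq_const (M := fun w => (M w.reverse)ᵀ) (α := β) (c := mrw)
    (u := u.reverse) (C := Rᵀ) (R := Cᵀ) (by simp [hM0])
    (fun u v => by simp [hMm]) (fun w i j => hUn _ _ _)
    (fun p q => by
      obtain ⟨w, hw⟩ := hSC q p
      exact ⟨w.reverse, by simpa using hw⟩) hβ
    (by
      conv_rhs => rw [← hβA]
      rw [← Matrix.vecMul_transpose, Matrix.transpose_smul, Matrix.transpose_sum]
      rfl)
    (by
      obtain ⟨x, ⟨w, q, rfl⟩, hx⟩ := hmrw₁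
      exact ⟨_, ⟨w.reverse, q, rfl⟩, by simpa [dotProduct_comm] using hx⟩)
    (by
      rintro y ⟨w, q, rfl⟩
      rw [dotProduct_comm]
      exact hmrw₂ _ ⟨w.reverse, q, rfl⟩)
    (fun i j => hR j i) (fun i j => UFA.nonneg_of_zero_or_one hC j i)
    (by simp [hCR])
    (fun v => by
      obtain ⟨P, hP, h⟩ := hinv v.reverse
      refine ⟨Pᵀ, fun i j => hP j i, ?_⟩
      have h' := congrArg Matrix.transpose (mul_eq_one_comm.mp h)
      simpa [Matrix.mul_assoc] using h')
  rw [Matrix.vecMul_transpose] at hrows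
  rw [← hu, hCR, ← Matrix.mulVec_mulVec, Matrix.dotProduct_mulVec, hcols, hrows, ← hCR]
  simp [dotProduct, mul_assoc]
end
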